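/- If ω_i is a minuscule (minimal) fundamental weight of a root system of type A_l, B_l, C_l or D_l and β = α_1 + ⋯ + α_l + Σ_j k_j α_j with k_j ≥ 0, then |Supp(ω_i − w_0ω_i − β)| < l. -/

import Mathlib

/-- The Cartan matrix of type `A_l` (entries `C i j = ⟨α_j, α_i^∨⟩`, Bourbaki numbering,
indices `0, …, l-1` standing for `α_1, …, α_l`). -/
def cartanA (l : ℕ) : Matrix (Fin l) (Fin l) ℤ :=
  Matrix.of fun i j =>
    if i = j then 2 else if i.1 + 1 = j.1 ∨ j.1 + 1 = i.1 then -1 else 0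

/-- The Cartan matrix of type `B_l` (`α_l` short, so `⟨α_{l-1}, α_l^∨⟩ = -2`). -/
def cartanB (l : ℕ) : Matrix (Fin l) (Fin l) ℤ :=
  Matrix.of fun i j =>
    if i = j then 2
    else if i.1 = l - 1 ∧ j.1 + 1 = i.1 then -2
    else if i.1 + 1 = j.1 ∨ j.1 + 1 = i.1 then -1 else 0

/-- The Cartan matrix of type `C_l` (`α_l` long, so `⟨α_l, α_{l-1}^∨⟩ = -2`). -/
def cartanC (l : ℕ) : Matrix (Fin l) (Fin l) ℤ :=
  Matrix.of fun i j =>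
    if i = j then 2
    else if j.1 = l - 1 ∧ i.1 + 1 = j.1 then -2
    else if i.1 + 1 = j.1 ∨ j.1 + 1 = i.1 then -1 else 0

/-- The Cartan matrix of type `D_l` (nodes `α_1 — ⋯ — α_{l-2} — α_{l-1}`, with `α_l`
also attached to `α_{l-2}`). -/
def cartanD (l : ℕ) : Matrix (Fin l) (Fin l) ℤ :=
  Matrix.of fun i j =>
    if i = j then 2
    else if (i.1 + 1 = j.1 ∨ j.1 + 1 = i.1) ∧ i.1 ≠ l - 1 ∧ j.1 ≠ l - 1 then -1
    else if (i.1 = l - 1 ∧ j.1 = l - 3) ∨ (j.1 = l - 1 ∧ i.1 = l - 3) then -1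
    else 0

/-- The simple reflection `s_i`, acting on weights written in coordinates with respect to
the basis of simple roots: `s_i v = v - ⟨v, α_i^∨⟩ α_i`, where `⟨v, α_i^∨⟩ = (C.mulVec v) i`. -/
def sref {l : ℕ} (C : Matrix (Fin l) (Fin l) ℚ) (i : Fin l) :
    Module.End ℚ (Fin l → ℚ) :=
  LinearMap.id - LinearMap.smulRight ((LinearMap.proj i).comp C.mulVecLin) (Pi.single i 1)

/-- The Weyl group, realized as the monoid generated by the simple reflections inside the
endomorphisms of the root space. -/
def weylGroup {l : ℕ} (C : Matrix (Fin l) (Fin l) ℚ) :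
    Submonoid (Module.End ℚ (Fin l → ℚ)) :=
  Submonoid.closure (Set.range (sref C))

/-- The coefficient of `α_n` (numbered from `1`) in a vector of the root space, extended by zero
to all natural numbers `n`. -/
def rootCoeff {l : ℕ} (v : Fin l → ℚ) (n : ℕ) : ℚ :=
  ∑ j : Fin l, if j.1 + 1 = n then v j else 0

theorem rootCoeff_succ {l : ℕ} (v : Fin l → ℚ) (j : Fin l) : rootCoeff v (j.1 + 1) = v j := by
  unfold rootCoeff
  rw [Finset.sum_eq_single j]
  · simp
  · intro b _ hb
    rw [if_neg]
    intro h
    exact hb (Fin.ext (by omega))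
  · simp

theorem rootCoeff_zero {l : ℕ} (v : Fin l → ℚ) : rootCoeff v 0 = 0 := by
  simp [rootCoeff]

theorem rootCoeff_of_lt {l : ℕ} (v : Fin l → ℚ) {n : ℕ} (h : l < n) : rootCoeff v n = 0 := by
  unfold rootCoeff
  refine Finset.sum_eq_zero fun j _ => if_neg ?_
  omega

theorem rootCoeff_comp_succ {l : ℕ} (f : ℕ → ℚ) (n : ℕ) :
    rootCoeff (fun j : Fin l => f (j.1 + 1)) n = if 1 ≤ n ∧ n ≤ l then f n else 0 := by
  split_ifs with h
  · obtain ⟨n, rfl⟩ := Nat.exists_eq_add_of_le' h.1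
    exact rootCoeff_succ (fun j : Fin l => f (j.1 + 1)) ⟨n, by omega⟩
  · rcases Nat.eq_zero_or_pos n with rfl | h0
    · exact rootCoeff_zero _
    · exact rootCoeff_of_lt _ (by omega)

theorem rootCoeff_sref {l : ℕ} (C : Matrix (Fin l) (Fin l) ℚ) (m : Fin l) (v : Fin l → ℚ)
    (n : ℕ) : rootCoeff (sref C m v) n =
      rootCoeff v n - if n = m.1 + 1 then C.mulVec v m else 0 := by
  have key : rootCoeff (Pi.single m (C.mulVec v m)) n =
      if n = m.1 + 1 then C.mulVec v m else 0 := by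
    unfold rootCoeff
    rw [Finset.sum_eq_single m]
    · simp [eq_comm]
    · intro b _ hb
      simp [hb]
    · simp
  rw [← key]
  unfold rootCoeff
  rw [← Finset.sum_sub_distrib]
  refine Finset.sum_congr rfl fun j _ => ?_
  by_cases hj : j = m
  · subst hj
    split_ifs <;> simp [sref]
  · split_ifs <;> simp [sref, hj]

theorem mulVec_cartanA {l : ℕ} (v : Fin l → ℚ) (m : Fin l) :
    ((cartanA l).map (Int.cast : ℤ → ℚ)).mulVec v m =
      2 * rootCoeff v (m + 1) - rootCoeff v m - rootCoeff v (m + 2) := by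
  simp only [rootCoeff, Matrix.mulVec, dotProduct, Finset.mul_sum, ← Finset.sum_sub_distrib]
  refine Finset.sum_congr rfl fun j _ => ?_
  simp only [cartanA, Matrix.map_apply, Matrix.of_apply, Fin.ext_iff]
  split_ifs <;> first | omega | (push_cast; ring)

theorem mulVec_cartanB {l : ℕ} (v : Fin l → ℚ) (m : Fin l) :
    ((cartanB l).map (Int.cast : ℤ → ℚ)).mulVec v m =
      2 * rootCoeff v (m + 1) - (if m.1 + 1 = l then 2 else 1) * rootCoeff v m
        - rootCoeff v (m + 2) := by
  simp only [rootCoeff, Matrix.mulVec, dotProduct, Finset.mul_sum, ← Finset.sum_sub_distrib]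
  refine Finset.sum_congr rfl fun j _ => ?_
  simp only [cartanB, Matrix.map_apply, Matrix.of_apply, Fin.ext_iff]
  split_ifs <;> first | omega | (push_cast; ring)

theorem mulVec_cartanC {l : ℕ} (v : Fin l → ℚ) (m : Fin l) :
    ((cartanC l).map (Int.cast : ℤ → ℚ)).mulVec v m =
      2 * rootCoeff v (m + 1) - rootCoeff v m
        - (if m.1 + 2 = l then 2 else 1) * rootCoeff v (m + 2) := by
  simp only [rootCoeff, Matrix.mulVec, dotProduct, Finset.mul_sum, ← Finset.sum_sub_distrib]
  refine Finset.sum_congr rfl fun j _ => ?_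
  simp only [cartanC, Matrix.map_apply, Matrix.of_apply, Fin.ext_iff]
  split_ifs <;> first | omega | (push_cast; ring)

theorem mulVec_cartanD {l : ℕ} (v : Fin (l + 4) → ℚ) (m : Fin (l + 4)) :
    ((cartanD (l + 4)).map (Int.cast : ℤ → ℚ)).mulVec v m =
      2 * rootCoeff v (m + 1) - (if m.1 = l + 3 then rootCoeff v (l + 2) else rootCoeff v m)
        - (if m.1 = l + 2 then 0 else rootCoeff v (m + 2))
        - (if m.1 = l + 1 then rootCoeff v (l + 4) else 0) := by
  have e1 : (if m.1 = l + 3 then rootCoeff v (l + 2) else rootCoeff v m) =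
      rootCoeff v (if m.1 = l + 3 then l + 2 else m) := by split_ifs <;> rfl
  have e2 : (if m.1 = l + 2 then 0 else rootCoeff v (m + 2)) =
      rootCoeff v (if m.1 = l + 2 then 0 else m + 2) := by
    split_ifs <;> simp [rootCoeff_zero]
  have e3 : (if m.1 = l + 1 then rootCoeff v (l + 4) else 0) =
      rootCoeff v (if m.1 = l + 1 then l + 4 else 0) := by
    split_ifs <;> simp [rootCoeff_zero]
  rw [e1, e2, e3]
  simp only [rootCoeff, Matrix.mulVec, dotProduct, Finset.mul_sum, ← Finset.sum_sub_distrib]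
  refine Finset.sum_congr rfl fun j _ => ?_
  simp only [cartanD, Matrix.map_apply, Matrix.of_apply, Fin.ext_iff]
  split_ifs <;> first | contradiction | omega | (push_cast; ring)

theorem weylGroup_apply_induction {l : ℕ} {C : Matrix (Fin l) (Fin l) ℚ}
    (P : (Fin l → ℚ) → Prop) (h : ∀ m v, P v → P (sref C m v))
    {w : Module.End ℚ (Fin l → ℚ)} (hw : w ∈ weylGroup C) : ∀ v, P v → P (w v) := by
  refine Submonoid.closure_induction (motive := fun w _ => ∀ v, P v → P (w v)) ?_ ?_ ?_ hw
  · rintro _ ⟨m, rfl⟩ v hv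
    exact h m v hv
  · intro v hv
    exact hv
  · intro x y _ _ hx hy v hv
    exact hx _ (hy v hv)

/-- If `t` is a sum of simple roots such that `ω_i - t` is dominant, and `ω_i` is minimal,
then `t = 0`. -/
theorem eq_zero_of_minimal {l : ℕ} {C : Matrix (Fin l) (Fin l) ℚ} {ω : Fin l → ℚ} {i : Fin l}
    (hω : C.mulVec ω = Pi.single i 1)
    (hmin : ∀ μ : Fin l → ℚ, (∃ n : Fin l → ℕ, C.mulVec μ = fun j => (n j : ℚ)) →
      (∃ t : Fin l → ℕ, ω - μ = fun j => (t j : ℚ)) → μ = ω)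
    (t n : ℕ → ℕ)
    (h : ∀ m : Fin l, C.mulVec (fun j => (t (j.1 + 1) : ℚ)) m =
      (if m = i then 1 else 0) - (n m : ℚ)) (j : Fin l) : t (j.1 + 1) = 0 := by
  have := hmin (ω - fun j => (t (j.1 + 1) : ℚ)) ⟨fun j => n j, ?_⟩ ⟨fun j => t (j.1 + 1), ?_⟩
  · have := congrFun this j
    simpa using this
  · funext m
    rw [Matrix.mulVec_sub, Pi.sub_apply, h m, hω, Pi.single_apply]
    ring
  · simp

theorem supp_cartanA {l : ℕ} (hl : 2 ≤ l) {ω : Fin l → ℚ} {i : Fin l}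
    (hω : ((cartanA l).map (Int.cast : ℤ → ℚ)).mulVec ω = Pi.single i 1)
    {w : Module.End ℚ (Fin l → ℚ)}
    (hw : w ∈ weylGroup ((cartanA l).map (Int.cast : ℤ → ℚ))) :
    ∃ j : Fin l, ω j - w ω j ≤ 1 := by
  set a := rootCoeff ω 1 with ha
  have row : ∀ m : Fin l, 2 * rootCoeff ω (m + 1) - rootCoeff ω m - rootCoeff ω (m + 2) =
      if m = i then 1 else 0 := fun m => by
    rw [← mulVec_cartanA, hω, Pi.single_apply]
  have base : ∀ n, n ≤ l → rootCoeff ω (n + 1) - rootCoeff ω n = if n ≤ i.1 then a else a - 1 := by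
    intro n
    induction n with
    | zero => simp [rootCoeff_zero, ha]
    | succ n ih =>
      intro hn
      have h1 := ih (by omega)
      have h2 := row ⟨n, by omega⟩
      simp only [Fin.ext_iff] at h2
      rw [show n + 1 + 1 = n + 2 from rfl]
      split_ifs at * <;> first | omega | linarith
  have inv := weylGroup_apply_induction (P := fun v => ∀ n, n ≤ l →
      rootCoeff v (n + 1) - rootCoeff v n = a ∨ rootCoeff v (n + 1) - rootCoeff v n = a - 1) (by
    intro m v h n hn
    have h0 := h n hn
    have h1 := h m (by omega)
    have h2 := h (m + 1) (by omega)
    simp only [rootCoeff_sref, mulVec_cartanA]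
    grind) hw ω (fun n hn => by rw [base n hn]; grind)
  have h0 := inv 0 (by omega)
  refine ⟨⟨0, by omega⟩, ?_⟩
  rw [← rootCoeff_succ ω, ← rootCoeff_succ (w ω)]
  simp only [rootCoeff_zero, zero_add] at h0 ⊢
  grind

theorem supp_cartanB {l : ℕ} (hl : 2 ≤ l) {ω : Fin l → ℚ} {i : Fin l}
    (hω : ((cartanB l).map (Int.cast : ℤ → ℚ)).mulVec ω = Pi.single i 1)
    {w : Module.End ℚ (Fin l → ℚ)}
    (hw : w ∈ weylGroup ((cartanB l).map (Int.cast : ℤ → ℚ)))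
    (hmin : ∀ μ : Fin l → ℚ,
      (∃ n : Fin l → ℕ, ((cartanB l).map (Int.cast : ℤ → ℚ)).mulVec μ = fun j => (n j : ℚ)) →
      (∃ t : Fin l → ℕ, ω - μ = fun j => (t j : ℚ)) → μ = ω) :
    ∃ j : Fin l, ω j - w ω j ≤ 1 := by
  have hi : i.1 + 1 = l := by
    by_contra hi
    have := eq_zero_of_minimal hω hmin (fun n => if i.1 + 1 ≤ n then 1 else 0)
      (fun n => if n + 1 = i.1 then 1 else 0) (fun m => by
        rw [mulVec_cartanB]
        simp only [rootCoeff_comp_succ (fun n => ((if i.1 + 1 ≤ n then 1 else 0 : ℕ) : ℚ)),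
          Fin.ext_iff]
        split_ifs <;> first | omega | norm_num) i
    simp at this
  have row : ∀ m : Fin l, 2 * rootCoeff ω (m + 1)
      - (if m.1 + 1 = l then 2 else 1) * rootCoeff ω m - rootCoeff ω (m + 2) =
      if m = i then 1 else 0 := fun m => by
    rw [← mulVec_cartanB, hω, Pi.single_apply]
  have base : ∀ k n, k + n + 1 = l → rootCoeff ω (n + 1) - rootCoeff ω n = 1 / 2 := by
    intro k
    induction k with
    | zero =>
      intro n hn
      have h2 := row ⟨n, by omega⟩
      have h3 := rootCoeff_of_lt ω (n := n + 2) (by omega)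
      simp only [Fin.ext_iff] at h2
      split_ifs at * <;> first | omega | linarith
    | succ k ih =>
      intro n hn
      have h1 := ih (n + 1) (by omega)
      have h2 := row ⟨n, by omega⟩
      simp only [Fin.ext_iff] at h2
      rw [show n + 1 + 1 = n + 2 from rfl] at h1
      split_ifs at * <;> first | omega | linarith
  have inv := weylGroup_apply_induction (P := fun v => ∀ n, n < l →
      rootCoeff v (n + 1) - rootCoeff v n = 1 / 2 ∨
        rootCoeff v (n + 1) - rootCoeff v n = - (1 / 2)) (by
    intro m v h n hn
    have h0 := h n hn
    have h1 := h m (by omega)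
    have h2 := h (m + 1)
    have h3 := rootCoeff_of_lt v (n := m + 2)
    simp only [rootCoeff_sref, mulVec_cartanB]
    grind) hw ω (fun n hn => Or.inl (base (l - n - 1) n (by omega)))
  have h0 := inv 0 (by omega)
  have h1 := base (l - 1) 0 (by omega)
  refine ⟨⟨0, by omega⟩, ?_⟩
  rw [← rootCoeff_succ ω, ← rootCoeff_succ (w ω)]
  simp only [rootCoeff_zero, zero_add] at h0 h1 ⊢
  grind

theorem supp_cartanC {l : ℕ} (hl : 2 ≤ l) {ω : Fin l → ℚ} {i : Fin l}
    (hω : ((cartanC l).map (Int.cast : ℤ → ℚ)).mulVec ω = Pi.single i 1)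
    {w : Module.End ℚ (Fin l → ℚ)}
    (hw : w ∈ weylGroup ((cartanC l).map (Int.cast : ℤ → ℚ)))
    (hmin : ∀ μ : Fin l → ℚ,
      (∃ n : Fin l → ℕ, ((cartanC l).map (Int.cast : ℤ → ℚ)).mulVec μ = fun j => (n j : ℚ)) →
      (∃ t : Fin l → ℕ, ω - μ = fun j => (t j : ℚ)) → μ = ω) :
    ∃ j : Fin l, ω j - w ω j ≤ 1 := by
  have hi : i.1 = 0 := by
    by_contra hi
    have := eq_zero_of_minimal hω hmin
      (fun n => if n < i.1 then 0 else if n = i.1 ∨ n = l then 1 else 2)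
      (fun n => if n + 2 = i.1 then 1 else 0) (fun m => by
        rw [mulVec_cartanC]
        simp only [rootCoeff_comp_succ
          (fun n => ((if n < i.1 then 0 else if n = i.1 ∨ n = l then 1 else 2 : ℕ) : ℚ)),
          Fin.ext_iff]
        split_ifs <;> first | omega | norm_num) i
    split_ifs at this
    omega
  have row : ∀ m : Fin l, 2 * rootCoeff ω (m + 1) - rootCoeff ω m
      - (if m.1 + 2 = l then 2 else 1) * rootCoeff ω (m + 2) =
      if m = i then 1 else 0 := fun m => by
    rw [← mulVec_cartanC, hω, Pi.single_apply]
  have last : 2 * rootCoeff ω l = rootCoeff ω (l - 1) := by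
    have h2 := row ⟨l - 1, by omega⟩
    have h3 := rootCoeff_of_lt ω (n := l - 1 + 2) (by omega)
    simp only [Fin.ext_iff] at h2
    rw [show l - 1 + 1 = l by omega] at h2
    split_ifs at * <;> first | omega | linarith
  have const : ∀ k n, k + n + 2 = l → rootCoeff ω (n + 1) = 2 * rootCoeff ω l ∧
      rootCoeff ω n = 2 * rootCoeff ω l - if n = 0 then 1 else 0 := by
    intro k
    induction k with
    | zero =>
      intro n hn
      have h2 := row ⟨n, by omega⟩
      simp only [Fin.ext_iff] at h2
      rw [show l - 1 = n + 1 by omega] at last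
      rw [show n + 2 = l by omega] at h2
      split_ifs at * <;> first | omega | (constructor <;> linarith)
    | succ k ih =>
      intro n hn
      have h1 := ih (n + 1) (by omega)
      have h2 := row ⟨n, by omega⟩
      simp only [Fin.ext_iff] at h2
      rw [show n + 1 + 1 = n + 2 from rfl] at h1
      split_ifs at * <;> first | omega | (constructor <;> linarith)
  have hlast : rootCoeff ω l = 1 / 2 := by
    have h1 := (const (l - 2) 0 (by omega)).2
    rw [rootCoeff_zero, if_pos rfl] at h1
    linarith
  have inv := weylGroup_apply_induction (P := fun v => ∃ s : ℚ, (s = 1 ∨ s = -1) ∧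
      ∃ k, 1 ≤ k ∧ k ≤ l ∧ ∀ n, n ≤ l →
        rootCoeff v n = if n < k then 0 else if n = l then s / 2 else s) (by
    rintro m v ⟨s, hs, k, hk1, hkl, h⟩
    have hm := m.2
    have h1 := h m (by omega)
    have h2 := h (m + 1) (by omega)
    have h3 := h (m + 2)
    have h4 := rootCoeff_of_lt v (n := m + 2)
    simp only [rootCoeff_sref, mulVec_cartanC]
    by_cases c1 : m.1 + 1 = k
    · by_cases c2 : k = l
      · exact ⟨-s, by grind, k, hk1, hkl, fun n hn => by have := h n hn; grind⟩
      · exact ⟨s, hs, k + 1, by omega, by omega, fun n hn => by have := h n hn; grind⟩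
    · by_cases c2 : m.1 + 2 = k
      · exact ⟨s, hs, k - 1, by omega, by omega, fun n hn => by have := h n hn; grind⟩
      · exact ⟨s, hs, k, hk1, hkl, fun n hn => by have := h n hn; grind⟩) hw ω
    ⟨1, Or.inl rfl, 1, le_rfl, by omega, fun n hn => by
      rcases Nat.eq_zero_or_pos n with rfl | h0
      · simp [rootCoeff_zero]
      · by_cases hnl : n = l
        · subst hnl
          rw [hlast]
          split_ifs <;> first | omega | norm_num
        · have := (const (l - 1 - n) (n - 1) (by omega)).1
          rw [show n - 1 + 1 = n by omega, hlast] at this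
          rw [this]
          split_ifs <;> first | omega | norm_num⟩
  obtain ⟨s, hs, k, hk1, hkl, h⟩ := inv
  have h0 := h l le_rfl
  refine ⟨⟨l - 1, by omega⟩, ?_⟩
  rw [← rootCoeff_succ ω, ← rootCoeff_succ (w ω)]
  simp only [show l - 1 + 1 = l by omega]
  grind

theorem supp_cartanD_vector {l : ℕ} {ω : Fin (l + 4) → ℚ} {i : Fin (l + 4)} (hi : i.1 = 0)
    (hω : ((cartanD (l + 4)).map (Int.cast : ℤ → ℚ)).mulVec ω = Pi.single i 1)
    {w : Module.End ℚ (Fin (l + 4) → ℚ)}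
    (hw : w ∈ weylGroup ((cartanD (l + 4)).map (Int.cast : ℤ → ℚ))) :
    ∃ j : Fin (l + 4), ω j - w ω j ≤ 1 := by
  have row := fun m =>
    (mulVec_cartanD ω m).symm.trans ((congrFun hω m).trans (Pi.single_apply i 1 m))
  have r3 := row ⟨l + 3, by omega⟩
  have r2 := row ⟨l + 2, by omega⟩
  have r4 := rootCoeff_of_lt ω (n := l + 5) (by omega)
  have const : ∀ k n, k + n = l + 1 → rootCoeff ω (n + 1) = 2 * rootCoeff ω (l + 4) ∧
      rootCoeff ω n = 2 * rootCoeff ω (l + 4) - if n = 0 then 1 else 0 := by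
    intro k
    induction k with
    | zero =>
      intro n hn
      obtain rfl : n = l + 1 := by omega
      have h2 := row ⟨l + 1, by omega⟩
      simp only [Fin.ext_iff] at h2 r2 r3
      grind
    | succ k ih =>
      intro n hn
      have h1 := ih (n + 1) (by omega)
      have h2 := row ⟨n, by omega⟩
      simp only [Fin.ext_iff] at h2
      grind
  have hlast : rootCoeff ω (l + 4) = 1 / 2 := by
    have h1 := (const (l + 1) 0 (by omega)).2
    rw [rootCoeff_zero, if_pos rfl] at h1
    linarith
  have hpen : rootCoeff ω (l + 3) = 1 / 2 := by
    simp only [Fin.ext_iff] at r2 r3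
    grind
  have inv := weylGroup_apply_induction (P := fun v => ∃ s : ℚ, (s = 1 ∨ s = -1) ∧
      ∃ k, 1 ≤ k ∧ k ≤ l + 4 ∧ rootCoeff v (l + 4) = s / 2 ∧
        rootCoeff v (l + 3) = (if k = l + 4 then - s / 2 else s / 2) ∧
        ∀ n, n ≤ l + 2 → rootCoeff v n = if n < k then 0 else s) (by
    rintro m v ⟨s, hs, k, hk1, hkl, h4, h3, h⟩
    have hm := m.2
    have h1 := h m
    have h2 := h (m + 1)
    have h5 := h (m + 2)
    have h6 := h (l + 2) le_rfl
    have h7 := rootCoeff_of_lt v (n := m + 2)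
    simp only [rootCoeff_sref, mulVec_cartanD]
    by_cases c0 : m.1 = l + 3
    · by_cases c1 : k = l + 4
      · exact ⟨-s, by grind, l + 3, by omega, by omega, by grind, by grind,
          fun n hn => by have := h n hn; grind⟩
      · by_cases c2 : k = l + 3
        · exact ⟨-s, by grind, l + 4, by omega, by omega, by grind, by grind,
            fun n hn => by have := h n hn; grind⟩
        · exact ⟨s, hs, k, hk1, hkl, by grind, by grind, fun n hn => by have := h n hn; grind⟩
    · by_cases c1 : m.1 + 1 = k
      · exact ⟨s, hs, k + 1, by omega, by omega, by grind, by grind,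
          fun n hn => by have := h n hn; grind⟩
      · by_cases c2 : m.1 + 2 = k
        · exact ⟨s, hs, k - 1, by omega, by omega, by grind, by grind,
            fun n hn => by have := h n hn; grind⟩
        · exact ⟨s, hs, k, hk1, hkl, by grind, by grind,
            fun n hn => by have := h n hn; grind⟩) hw ω
    ⟨1, Or.inl rfl, 1, le_rfl, by omega, hlast, by rw [hpen]; simp, fun n hn => by
      rcases Nat.eq_zero_or_pos n with rfl | h0
      · simp [rootCoeff_zero]
      · have := (const (l + 2 - n) (n - 1) (by omega)).1
        rw [show n - 1 + 1 = n by omega, hlast] at this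
        rw [this, if_neg (by omega)]
        norm_num⟩
  obtain ⟨s, hs, k, -, -, h0, -⟩ := inv
  refine ⟨⟨l + 3, by omega⟩, ?_⟩
  rw [← rootCoeff_succ ω, ← rootCoeff_succ (w ω)]
  simp only
  grind

theorem supp_cartanD_spin {l : ℕ} {ω : Fin (l + 4) → ℚ} {i : Fin (l + 4)} (hi : l + 2 ≤ i.1)
    (hω : ((cartanD (l + 4)).map (Int.cast : ℤ → ℚ)).mulVec ω = Pi.single i 1)
    {w : Module.End ℚ (Fin (l + 4) → ℚ)}
    (hw : w ∈ weylGroup ((cartanD (l + 4)).map (Int.cast : ℤ → ℚ))) :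
    ∃ j : Fin (l + 4), ω j - w ω j ≤ 1 := by
  have row := fun m =>
    (mulVec_cartanD ω m).symm.trans ((congrFun hω m).trans (Pi.single_apply i 1 m))
  have r3 := row ⟨l + 3, by omega⟩
  have r2 := row ⟨l + 2, by omega⟩
  have r4 := rootCoeff_of_lt ω (n := l + 5) (by omega)
  have hi' := i.2
  simp only [Fin.ext_iff] at r2 r3
  have base : ∀ k n, k + n = l + 1 → rootCoeff ω (n + 1) - rootCoeff ω n = 1 / 2 := by
    intro k
    induction k with
    | zero =>
      intro n hn
      obtain rfl : n = l + 1 := by omega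
      have h2 := row ⟨l + 1, by omega⟩
      simp only [Fin.ext_iff] at h2
      grind
    | succ k ih =>
      intro n hn
      have h1 := ih (n + 1) (by omega)
      have h2 := row ⟨n, by omega⟩
      simp only [Fin.ext_iff] at h2
      grind
  have inv := weylGroup_apply_induction (P := fun v =>
      (∀ n, n ≤ l + 1 → rootCoeff v (n + 1) - rootCoeff v n = 1 / 2 ∨
        rootCoeff v (n + 1) - rootCoeff v n = - (1 / 2)) ∧
      (rootCoeff v (l + 3) + rootCoeff v (l + 4) - rootCoeff v (l + 2) = 1 / 2 ∨
        rootCoeff v (l + 3) + rootCoeff v (l + 4) - rootCoeff v (l + 2) = - (1 / 2)) ∧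
      (rootCoeff v (l + 4) - rootCoeff v (l + 3) = 1 / 2 ∨
        rootCoeff v (l + 4) - rootCoeff v (l + 3) = - (1 / 2))) (by
    rintro m v ⟨h, h3, h4⟩
    have hm := m.2
    have h1 := h m
    have h2 := h (m + 1)
    have h6 := h (l + 1) le_rfl
    have h7 := rootCoeff_of_lt v (n := m + 2)
    simp only [rootCoeff_sref, mulVec_cartanD]
    refine ⟨fun n hn => ?_, ?_, ?_⟩
    · have := h n hn
      grind
    · grind
    · grind) hw ω ⟨fun n hn => Or.inl (base (l + 1 - n) n (by omega)), by grind, by grind⟩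
  have h0 := inv.1 0 (by omega)
  have h1 := base (l + 1) 0 (by omega)
  refine ⟨⟨0, by omega⟩, ?_⟩
  rw [← rootCoeff_succ ω, ← rootCoeff_succ (w ω)]
  simp only [rootCoeff_zero, zero_add] at h0 h1 ⊢
  grind

theorem supp_cartanD {l : ℕ} {ω : Fin (l + 4) → ℚ} {i : Fin (l + 4)}
    (hω : ((cartanD (l + 4)).map (Int.cast : ℤ → ℚ)).mulVec ω = Pi.single i 1)
    {w : Module.End ℚ (Fin (l + 4) → ℚ)}
    (hw : w ∈ weylGroup ((cartanD (l + 4)).map (Int.cast : ℤ → ℚ)))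
    (hmin : ∀ μ : Fin (l + 4) → ℚ, (∃ n : Fin (l + 4) → ℕ,
        ((cartanD (l + 4)).map (Int.cast : ℤ → ℚ)).mulVec μ = fun j => (n j : ℚ)) →
      (∃ t : Fin (l + 4) → ℕ, ω - μ = fun j => (t j : ℚ)) → μ = ω) :
    ∃ j : Fin (l + 4), ω j - w ω j ≤ 1 := by
  by_cases h0 : i.1 = 0
  · exact supp_cartanD_vector h0 hω hw
  by_cases h1 : l + 2 ≤ i.1
  · exact supp_cartanD_spin h1 hω hw
  have := eq_zero_of_minimal hω hmin
    (fun n => if n < i.1 then 0 else if n = i.1 ∨ l + 2 < n then 1 else 2)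
    (fun n => if n + 2 = i.1 then 1 else 0) (fun m => by
      rw [mulVec_cartanD]
      simp only [rootCoeff_comp_succ
        (fun n => ((if n < i.1 then 0 else if n = i.1 ∨ l + 2 < n then 1 else 2 : ℕ) : ℚ)),
        Fin.ext_iff]
      push_cast
      grind) i
  split_ifs at this
  omega

/-- If `ω_i` is a minuscule (minimal) fundamental weight of a root system of type
`A_l, B_l, C_l` (`l ≥ 2`) or `D_l` (`l ≥ 4`) and `β = α_1 + ⋯ + α_l + Σ_j k_j α_j` with
`k_j ≥ 0`, then `|Supp(ω_i − w0 ω_i − β)| < l`: some simple-root coefficient of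
`ω_i − w0 ω_i − β` is `≤ 0`.  Weights are written in coordinates w.r.t. the simple-root
basis; `ω i` is characterized by `⟨ω_i, α_j^∨⟩ = δ_{ij}`, `w0` is the Weyl group element
sending every simple root to the negative of a simple root, and minusculity of `ω_i` is
expressed (equivalently to `Π(ω_i)` being a single Weyl orbit) by saying that the only
dominant integral weight `μ ⪯ ω_i` is `ω_i` itself. -/
theorem supp_minuscule_lt (l : ℕ) (hl : 2 ≤ l)
    (C : Matrix (Fin l) (Fin l) ℤ)
    (hC : C = cartanA l ∨ C = cartanB l ∨ C = cartanC l ∨ (C = cartanD l ∧ 4 ≤ l))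
    (ω : Fin l → (Fin l → ℚ))
    (hω : ∀ i, (C.map (Int.cast : ℤ → ℚ)).mulVec (ω i) = Pi.single i 1)
    (w0 : Module.End ℚ (Fin l → ℚ))
    (hw0 : w0 ∈ weylGroup (C.map (Int.cast : ℤ → ℚ)))
    (hlong : ∀ i : Fin l, ∃ j : Fin l, w0 (Pi.single i 1) = -Pi.single j 1)
    (i : Fin l)
    (hmin : ∀ μ : Fin l → ℚ,
      (∃ n : Fin l → ℕ, (C.map (Int.cast : ℤ → ℚ)).mulVec μ = fun j => (n j : ℚ)) →
      (∃ t : Fin l → ℕ, ω i - μ = fun j => (t j : ℚ)) → μ = ω i)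
    (k : Fin l → ℕ) :
    ∃ j : Fin l, ω i j - w0 (ω i) j - (1 + (k j : ℚ)) ≤ 0 := by
  obtain ⟨j, hj⟩ : ∃ j : Fin l, ω i j - w0 (ω i) j ≤ 1 := by
    rcases hC with rfl | rfl | rfl | ⟨rfl, hl4⟩
    · exact supp_cartanA hl (hω i) hw0
    · exact supp_cartanB hl (hω i) hw0 hmin
    · exact supp_cartanC hl (hω i) hw0 hmin
    · obtain ⟨l, rfl⟩ := Nat.exists_eq_add_of_le' hl4
      exact supp_cartanD (hω i) hw0 hmin
  refine ⟨j, ?_⟩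
  have := Nat.cast_nonneg (α := ℚ) (k j)
  linarith
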